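/- Let q be an odd prime power. For every k ∈ {1,…,q−2} with k ≠ (q−1)/2, the point set E_k of PG(3,q²) has cardinality q²(q²+1)(q+1)/2 + q² + 1. -/

import Mathlib

noncomputable section

open Matrix

/-- The points of `PG(3,q²)`: the projectivization of `F⁴` where `F = 𝔽_{q²}`. -/
abbrev PGPoint (F : Type*) [Field F] := Projectivization F (Fin 4 → F)

/-- The form `F_γ(X₁,X₂,X₃,X₄) = X₁^q X₄ + X₁ X₄^q − X₂^{q+1} − X₃^{q+1}
    − γ (X₁X₄ − X₂X₃)^{(q+1)/2}`. -/
def Fgam {F : Type*} [Field F] (q : ℕ) (γ : F) (x : Fin 4 → F) : F :=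
  x 0 ^ q * x 3 + x 0 * x 3 ^ q - x 1 ^ (q + 1) - x 2 ^ (q + 1)
    - γ * (x 0 * x 3 - x 1 * x 2) ^ ((q + 1) / 2)

/-- The point set `C_γ` of `PG(3,q²)`, the zero locus of `F_γ`. -/
def Cgam {F : Type*} [Field F] (q : ℕ) (γ : F) : Set (PGPoint F) :=
  {P | ∀ (v : Fin 4 → F) (hv : v ≠ 0), P = Projectivization.mk F v hv → Fgam q γ v = 0}

/-- Kronecker product of two 2×2 matrices, as a 4×4 matrix. -/
def kron {F : Type*} [Field F] (A B : Matrix (Fin 2) (Fin 2) F) :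
    Matrix (Fin 4) (Fin 4) F :=
  Matrix.of fun i j =>
    A ⟨i.val / 2, by have := i.isLt; omega⟩ ⟨j.val / 2, by have := j.isLt; omega⟩ *
    B ⟨i.val % 2, by have := i.isLt; omega⟩ ⟨j.val % 2, by have := j.isLt; omega⟩

/-- Entrywise `q`-th power (the matrix `A^q`). -/
def matq {F : Type*} [Field F] (q : ℕ) (A : Matrix (Fin 2) (Fin 2) F) :
    Matrix (Fin 2) (Fin 2) F :=
  A.map (· ^ q)

/-- The orbit of a point of `PG(3,q²)` under the group `K ≅ PSL(2,q²)` of projectivities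
    induced by the matrices `A^q ⊗ A` with `A ∈ SL(2,𝔽_{q²})`. -/
def Korb {F : Type*} [Field F] (q : ℕ) (P : PGPoint F) : Set (PGPoint F) :=
  {P' | ∃ A : Matrix (Fin 2) (Fin 2) F, A.det = 1 ∧
    ∃ (v : Fin 4 → F) (hv : v ≠ 0) (hw : Matrix.vecMul v (kron (matq q A) A) ≠ 0),
      P = Projectivization.mk F v hv ∧ P' = Projectivization.mk F _ hw}

/-- The orbit of a point of `PG(3,q²)` under the group `G ≅ PGL(2,q²)` of projectivities
    induced by the matrices `A^q ⊗ A` with `A ∈ GL(2,𝔽_{q²})`. -/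
def Gorb {F : Type*} [Field F] (q : ℕ) (P : PGPoint F) : Set (PGPoint F) :=
  {P' | ∃ A : Matrix (Fin 2) (Fin 2) F, A.det ≠ 0 ∧
    ∃ (v : Fin 4 → F) (hv : v ≠ 0) (hw : Matrix.vecMul v (kron (matq q A) A) ≠ 0),
      P = Projectivization.mk F v hv ∧ P' = Projectivization.mk F _ hw}

/-- The Hermitian Veronese curve `O = {(1,t,t^q,t^{q+1})} ∪ {(0,0,0,1)}`. -/
def Oset (F : Type*) [Field F] (q : ℕ) : Set (PGPoint F) :=
  {P | (∃ (t : F) (hv : ![1, t, t ^ q, t ^ (q + 1)] ≠ 0),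
        P = Projectivization.mk F _ hv) ∨
    ∃ (hv : (![0, 0, 0, 1] : Fin 4 → F) ≠ 0), P = Projectivization.mk F _ hv}

/-- The Baer subgeometry `Σ = {(a,b,b^q,c) : a,c ∈ 𝔽_q, b ∈ 𝔽_{q²}}`. -/
def SigmaSet (F : Type*) [Field F] (q : ℕ) : Set (PGPoint F) :=
  {P | ∃ (a b c : F) (hv : ![a, b, b ^ q, c] ≠ 0),
    a ^ q = a ∧ c ^ q = c ∧ P = Projectivization.mk F _ hv}

/-- The hyperbolic quadric `Q⁺(3,q²) : X₁X₄ − X₂X₃ = 0`. -/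
def Qplus (F : Type*) [Field F] : Set (PGPoint F) :=
  {P | ∀ (v : Fin 4 → F) (hv : v ≠ 0), P = Projectivization.mk F v hv →
    v 0 * v 3 - v 1 * v 2 = 0}

/-- A line of `PG(3,q²)`: the set of points lying in a 2-dimensional subspace. -/
def IsLine {F : Type*} [Field F] (ℓ : Set (PGPoint F)) : Prop :=
  ∃ W : Submodule F (Fin 4 → F), Module.finrank F W = 2 ∧ ℓ = {P | P.rep ∈ W}

/-- A plane of `PG(3,q²)`: the set of points lying in a 3-dimensional subspace. -/
def IsPlane {F : Type*} [Field F] (π : Set (PGPoint F)) : Prop :=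
  ∃ W : Submodule F (Fin 4 → F), Module.finrank F W = 3 ∧ π = {P | P.rep ∈ W}

section Counting

open Finset

theorem card_filter_prod {α β : Type*} [Fintype α] [Fintype β] (P : α → β → Prop)
    [∀ a b, Decidable (P a b)] :
    #{p : α × β | P p.1 p.2} = ∑ a, #{b | P a b} := by
  simp only [card_filter, Fintype.sum_prod_type]

variable {F : Type*} [Field F]

/-- A generator of the multiplicative group of a finite field is a primitive root of unity. -/
theorem isPrimitiveRoot_of_generates [Fintype F] {ξ : F} (h0 : ξ ≠ 0)
    (hξ : ∀ x : F, x ≠ 0 → ∃ m : ℕ, x = ξ ^ m) :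
    IsPrimitiveRoot ξ (Fintype.card F - 1) := by
  have hgen : ∀ x : Fˣ, x ∈ Subgroup.zpowers (Units.mk0 ξ h0) := fun x => by
    obtain ⟨m, hm⟩ := hξ x x.ne_zero
    exact ⟨m, Units.ext (by simp [hm])⟩
  have h := orderOf_eq_card_of_forall_mem_zpowers hgen
  rw [Nat.card_units, Nat.card_eq_fintype_card] at h
  rw [← h]
  exact IsPrimitiveRoot.coe_units_iff.mpr (IsPrimitiveRoot.orderOf (Units.mk0 ξ h0))

theorem card_filter_pow_eq [Fintype F] [DecidableEq F] {ξ c : F} {m l : ℕ} (hm : 0 < m)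
    (hl : 0 < l) (hξ : ∀ x : F, x ≠ 0 → ∃ m : ℕ, x = ξ ^ m) (hp : IsPrimitiveRoot ξ (m * l))
    (hc : c ^ l = 1) : #{y : F | y ^ m = c} = m := by
  have hc0 : c ≠ 0 := by
    rintro rfl
    simp [hl.ne'] at hc
  have hprim : IsPrimitiveRoot (ξ ^ l) m := hp.pow (Nat.mul_pos hm hl) (mul_comm m l)
  obtain ⟨j, rfl⟩ := hξ c hc0
  rw [← pow_mul, hp.pow_eq_one_iff_dvd] at hc
  obtain ⟨i, rfl⟩ := Nat.dvd_of_mul_dvd_mul_right hl hc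
  have hcard := hprim.card_nthRoots (ξ ^ (m * i))
  rw [if_pos ⟨ξ ^ i, by rw [← pow_mul, mul_comm]⟩] at hcard
  rw [← Multiset.toFinset_card_of_nodup (hprim.nthRoots_nodup hc0)] at hcard
  rw [← hcard]
  congr 1
  ext y
  simp [Polynomial.mem_nthRoots hm, hcard]

theorem Fgam_smul (q : ℕ) (hq : Odd q) (γ t : F) (v : Fin 4 → F) :
    Fgam q γ (t • v) = t ^ (q + 1) * Fgam q γ v := by
  obtain ⟨r, rfl⟩ := hq
  have h : (2 * r + 1 + 1) / 2 = r + 1 := by omega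
  simp only [Fgam, Pi.smul_apply, smul_eq_mul, h]
  rw [show t * v 0 * (t * v 3) - t * v 1 * (t * v 2) = t ^ 2 * (v 0 * v 3 - v 1 * v 2) by ring,
    mul_pow (t ^ 2), ← pow_mul]
  ring

theorem mk_mem_Cgam_iff (q : ℕ) (hq : Odd q) (γ : F) (v : Fin 4 → F) (hv : v ≠ 0) :
    Projectivization.mk F v hv ∈ Cgam q γ ↔ Fgam q γ v = 0 := by
  refine ⟨fun h => h v hv rfl, fun h w hw hvw => ?_⟩
  obtain ⟨a, rfl⟩ := (Projectivization.mk_eq_mk_iff' F _ _ hv hw).1 hvw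
  rw [Fgam_smul q hq] at h
  refine (mul_eq_zero.1 h).resolve_left (pow_ne_zero _ ?_)
  rintro rfl
  simp at hv

/-- The points with first coordinate `1`. -/
def pointOne (p : F × F × F) : PGPoint F :=
  Projectivization.mk F ![1, p.1, p.2.1, p.2.2] (fun h => by simpa using congrFun h 0)

/-- The points whose first two coordinates are `0, 1`. -/
def pointZeroOne (p : F × F) : PGPoint F :=
  Projectivization.mk F ![0, 1, p.1, p.2] (fun h => by simpa using congrFun h 1)

/-- The point `(0,0,0,1)`. -/
def pointInfinity : PGPoint F :=
  Projectivization.mk F ![0, 0, 0, 1] (fun h => by simpa using congrFun h 3)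

theorem pointOne_injective : Function.Injective (pointOne (F := F)) := by
  rintro ⟨a, b, c⟩ ⟨a', b', c'⟩ h
  obtain ⟨t, ht⟩ := (Projectivization.mk_eq_mk_iff' F _ _ _ _).1 h
  simp at ht
  obtain ⟨rfl, h1, h2, h3⟩ := ht
  simp [← h1, ← h2, ← h3]

theorem pointZeroOne_injective : Function.Injective (pointZeroOne (F := F)) := by
  rintro ⟨b, c⟩ ⟨b', c'⟩ h
  obtain ⟨t, ht⟩ := (Projectivization.mk_eq_mk_iff' F _ _ _ _).1 h
  simp at ht
  obtain ⟨rfl, h2, h3⟩ := ht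
  simp [← h2, ← h3]

theorem pointZeroOne_ne_pointOne (p : F × F × F) (s : F × F) : pointZeroOne s ≠ pointOne p := by
  intro h
  obtain ⟨t, ht⟩ := (Projectivization.mk_eq_mk_iff' F _ _ _ _).1 h
  simp at ht
  obtain ⟨rfl, h1, -⟩ := ht
  simp at h1

theorem pointInfinity_ne_pointOne (p : F × F × F) : pointInfinity ≠ pointOne p := by
  intro h
  obtain ⟨t, ht⟩ := (Projectivization.mk_eq_mk_iff' F _ _ _ _).1 h
  simp at ht
  obtain ⟨rfl, -, -, h1⟩ := ht
  simp at h1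

theorem pointInfinity_ne_pointZeroOne (s : F × F) : pointInfinity ≠ pointZeroOne s := by
  intro h
  obtain ⟨t, ht⟩ := (Projectivization.mk_eq_mk_iff' F _ _ _ _).1 h
  simp at ht
  obtain ⟨rfl, -, h1⟩ := ht
  simp at h1

theorem Cgam_eq_union (q : ℕ) (hq : Odd q) (γ : F) :
    Cgam q γ = insert pointInfinity
      (pointOne '' {p | Fgam q γ ![1, p.1, p.2.1, p.2.2] = 0} ∪
        pointZeroOne '' {p | Fgam q γ ![0, 1, p.1, p.2] = 0}) := by
  have hpos : (q + 1) / 2 ≠ 0 := by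
    have := hq.pos
    omega
  ext P
  constructor
  · induction P using Projectivization.ind with | h v hv => ?_
    rw [mk_mem_Cgam_iff q hq]
    intro h
    have key : ∀ (t : F) (w : Fin 4 → F), t ≠ 0 → v = t • w → Fgam q γ w = 0 := by
      rintro t w ht rfl
      rw [Fgam_smul q hq] at h
      exact (mul_eq_zero.1 h).resolve_left (pow_ne_zero _ ht)
    by_cases h0 : v 0 = 0
    · by_cases h1 : v 1 = 0
      · have h2 : v 2 = 0 := by
          simpa [Fgam, h0, h1, hq.pos.ne', hpos] using h
        left
        refine (Projectivization.mk_eq_mk_iff' F _ _ _ _).2 ⟨v 3, ?_⟩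
        ext i
        fin_cases i <;> simp [h0, h1, h2]
      · have hw : v = v 1 • ![0, 1, v 2 / v 1, v 3 / v 1] := by
          ext i
          fin_cases i <;> simp [h0] <;> field_simp
        exact Or.inr (Or.inr ⟨(v 2 / v 1, v 3 / v 1), key _ _ h1 hw,
          ((Projectivization.mk_eq_mk_iff' F _ _ _ _).2 ⟨v 1, hw.symm⟩).symm⟩)
    · have hw : v = v 0 • ![1, v 1 / v 0, v 2 / v 0, v 3 / v 0] := by
        ext i
        fin_cases i <;> simp <;> field_simp
      exact Or.inr (Or.inl ⟨(v 1 / v 0, v 2 / v 0, v 3 / v 0), key _ _ h0 hw,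
        ((Projectivization.mk_eq_mk_iff' F _ _ _ _).2 ⟨v 0, hw.symm⟩).symm⟩)
  · rintro (rfl | ⟨p, hp, rfl⟩ | ⟨p, hp, rfl⟩)
    · exact (mk_mem_Cgam_iff q hq _ _ _).2 (by simp [Fgam, hq.pos.ne', hpos])
    · exact (mk_mem_Cgam_iff q hq _ _ _).2 hp
    · exact (mk_mem_Cgam_iff q hq _ _ _).2 hp

theorem ncard_Cgam_eq [Fintype F] [DecidableEq F] (q : ℕ) (hq : Odd q) (γ : F) :
    (Cgam q γ).ncard = #{p : F × F × F | Fgam q γ ![1, p.1, p.2.1, p.2.2] = 0} +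
      #{p : F × F | Fgam q γ ![0, 1, p.1, p.2] = 0} + 1 := by
  rw [Cgam_eq_union q hq, Set.ncard_insert_of_notMem, Set.ncard_union_eq,
    Set.ncard_image_of_injective _ pointOne_injective,
    Set.ncard_image_of_injective _ pointZeroOne_injective,
    Set.ncard_eq_toFinset_card', Set.ncard_eq_toFinset_card']
  · simp only [Set.toFinset_ofPred]
  · rw [Set.disjoint_left]
    rintro _ ⟨p, -, rfl⟩ ⟨s, -, h⟩
    exact pointZeroOne_ne_pointOne p s h
  · rintro (⟨p, -, h⟩ | ⟨p, -, h⟩)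
    · exact pointInfinity_ne_pointOne p h.symm
    · exact pointInfinity_ne_pointZeroOne p h.symm

/-- In the affine part, the equation `F_γ = 0` becomes a norm equation in the coordinates
`y = a - b^q` and `d = c - ab`. -/
theorem card_affine_eq [Fintype F] [DecidableEq F] (q : ℕ) (γ : F)
    (hadd : ∀ x y : F, (x + y) ^ q = x ^ q + y ^ q) (hinv : ∀ x : F, (x ^ q) ^ q = x) :
    #{p : F × F × F | Fgam q γ ![1, p.1, p.2.1, p.2.2] = 0} =
      Fintype.card F *
        ∑ d : F, #{y : F | y ^ (q + 1) = d + d ^ q - γ * d ^ ((q + 1) / 2)} := by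
  have hsub : ∀ x y : F, (x - y) ^ q = x ^ q - y ^ q := fun x y => by
    rw [eq_sub_iff_add_eq, ← hadd, sub_add_cancel]
  rw [← card_filter_prod fun d y => y ^ (q + 1) = d + d ^ q - γ * d ^ ((q + 1) / 2),
    ← card_univ (α := F), ← card_product]
  refine card_nbij' (fun p => (p.2.1, p.2.2 - p.1 * p.2.1, p.1 - p.2.1 ^ q))
    (fun p => (p.2.2 + p.1 ^ q, p.1, p.2.1 + (p.2.2 + p.1 ^ q) * p.1)) ?_ ?_ ?_ ?_
  · rintro ⟨a, b, c⟩ h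
    simp only [Fgam, coe_filter, mem_univ, true_and, Set.mem_ofPred_eq, Matrix.cons_val, one_pow,
      one_mul, coe_product, coe_univ, Set.mem_prod, Set.mem_univ, pow_succ, hsub, mul_pow, hinv]
      at h ⊢
    linear_combination (-1) * h
  · rintro ⟨b, d, y⟩ h
    simp only [Fgam, coe_filter, mem_univ, true_and, Set.mem_ofPred_eq, Matrix.cons_val, one_pow,
      one_mul, coe_product, coe_univ, Set.mem_prod, Set.mem_univ, pow_succ, hadd, mul_pow, hinv,
      add_sub_cancel_right]
      at h ⊢
    linear_combination (-1) * h
  · rintro ⟨a, b, c⟩ -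
    simp
  · rintro ⟨b, d, y⟩ -
    simp

theorem card_affine [Fintype F] [DecidableEq F] {ξ : F} {r k : ℕ} (hr : 0 < r)
    (hcard : Fintype.card F = (2 * r + 1) ^ 2)
    (hadd : ∀ x y : F, (x + y) ^ (2 * r + 1) = x ^ (2 * r + 1) + y ^ (2 * r + 1))
    (hξ : ∀ x : F, x ≠ 0 → ∃ m : ℕ, x = ξ ^ m)
    (hp : IsPrimitiveRoot ξ ((2 * r + 2) * (2 * r))) {l : F} (hl0 : l ≠ 0) (hl4 : l ^ 4 ≠ 1)
    (hlq : l ^ (2 * r) = (-1) ^ k) :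
    #{p : F × F × F | Fgam (2 * r + 1) (l + l⁻¹) ![1, p.1, p.2.1, p.2.2] = 0} =
      (2 * r + 1) ^ 2 * (1 + 2 * r * (r + 1) * (2 * r + 2)) := by
  have hF1 : ∀ x : F, x ≠ 0 → x ^ ((2 * r + 2) * (2 * r)) = 1 := fun x hx => by
    obtain ⟨m, rfl⟩ := hξ x hx
    rw [← pow_mul, mul_comm, pow_mul, hp.pow_eq_one, one_pow]
  have hinv : ∀ x : F, (x ^ (2 * r + 1)) ^ (2 * r + 1) = x := fun x => by
    rw [← pow_mul, ← sq, ← hcard, FiniteField.pow_card]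
  have hsub : ∀ x y : F, (x - y) ^ (2 * r + 1) = x ^ (2 * r + 1) - y ^ (2 * r + 1) :=
    fun x y => by rw [eq_sub_iff_add_eq, ← hadd, sub_add_cancel]
  have hε : ((-1 : F) ^ k) ^ 2 = 1 := by rw [← pow_mul, mul_comm, pow_mul]; simp
  have hε' : ((-1 : F) ^ k)⁻¹ = (-1 : F) ^ k := by
    rw [inv_eq_iff_eq_inv, ← inv_pow]; simp
  have hγ : (l + l⁻¹) ≠ 0 := fun h => hl4 (by
    field_simp at h
    linear_combination (l ^ 2 - 1) * h)
  have hγq : (l + l⁻¹) ^ (2 * r + 1) = (-1) ^ k * (l + l⁻¹) := by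
    rw [hadd, inv_pow, pow_succ, hlq, mul_inv, hε']
    ring
  rw [card_affine_eq _ _ hadd hinv, hcard]
  congr 1
  have hne : ∀ d : F, d ≠ 0 → d + d ^ (2 * r + 1) - (l + l⁻¹) * d ^ (r + 1) ≠ 0 := by
    intro d hd h
    have hfac : (d ^ r - l) * (d ^ r * l - 1) = 0 := by
      have : d * ((d ^ r - l) * (d ^ r * l - 1)) = 0 := by
        field_simp at h
        linear_combination h
      exact (mul_eq_zero.1 this).resolve_left hd
    have hs : (d ^ r) ^ (2 * (2 * r + 2)) = 1 := by
      rw [← hF1 d hd]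
      ring
    have hls : l ^ (2 * (2 * r + 2)) = l ^ 4 := by
      rw [show 2 * (2 * r + 2) = 2 * r * 2 + 4 by ring, pow_add, pow_mul, hlq, hε, one_mul]
    rw [← hls] at hl4
    rcases mul_eq_zero.1 hfac with h | h
    · exact hl4 (by rw [← sub_eq_zero.1 h, hs])
    · have h2 := congrArg (· ^ (2 * (2 * r + 2))) (sub_eq_zero.1 h)
      simp only [mul_pow (d ^ r), hs, one_mul, one_pow] at h2
      exact hl4 h2
  have hterm : ∀ d : F,
      #{y : F | y ^ (2 * r + 1 + 1) =
        d + d ^ (2 * r + 1) - (l + l⁻¹) * d ^ ((2 * r + 1 + 1) / 2)} =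
      (if d = 0 then 1 else 0) +
        if d ^ ((2 * r) * (r + 1)) = (-1) ^ k then 2 * r + 2 else 0 := by
    intro d
    rw [show (2 * r + 1 + 1) / 2 = r + 1 by omega]
    by_cases hd : d = 0
    · subst hd
      have h1 : (0 : F) ^ (2 * r * (r + 1)) ≠ (-1) ^ k := by
        rw [zero_pow (by positivity)]
        exact (pow_ne_zero _ (by simp)).symm
      rw [if_pos rfl, if_neg h1]
      simp [filter_eq']
    · set c := d + d ^ (2 * r + 1) - (l + l⁻¹) * d ^ (r + 1) with hc
      have hc0 : c ≠ 0 := hne d hd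
      have hcq : c ^ (2 * r + 1) =
          d + d ^ (2 * r + 1) - (-1) ^ k * (l + l⁻¹) * (d ^ (r + 1) * d ^ (2 * r * (r + 1))) := by
        rw [hc, hsub, hadd, hinv, mul_pow, hγq]
        ring
      have hiff : c ^ (2 * r) = 1 ↔ d ^ (2 * r * (r + 1)) = (-1) ^ k := by
        have h1 : c ^ (2 * r) = 1 ↔ c ^ (2 * r + 1) = c := by
          rw [pow_succ, mul_eq_right₀ hc0]
        rw [h1, hcq, hc]
        constructor
        · intro h
          have h2 : (l + l⁻¹) * d ^ (r + 1) * (d ^ (2 * r * (r + 1)) - (-1) ^ k) = 0 := by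
            linear_combination (-(-1) ^ k) * h -
              (l + l⁻¹) * d ^ (r + 1) * d ^ (2 * r * (r + 1)) * hε
          exact sub_eq_zero.1
            ((mul_eq_zero.1 h2).resolve_left (mul_ne_zero hγ (pow_ne_zero _ hd)))
        · intro h
          rw [h]
          linear_combination (-(l + l⁻¹) * d ^ (r + 1)) * hε
      rw [if_neg hd, zero_add]
      split_ifs with h <;> rw [← hiff] at h
      · exact card_filter_pow_eq (by positivity) (by positivity) hξ hp h
      · rw [card_eq_zero, filter_eq_empty_iff]
        intro y _ hy
        refine h ?_
        have hy0 : y ≠ 0 := by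
          rintro rfl
          exact hc0 (by rw [← hy]; simp)
        rw [← hy, ← pow_mul]
        exact hF1 y hy0
  have hhalf : #{d : F | d ^ ((2 * r) * (r + 1)) = (-1) ^ k} = 2 * r * (r + 1) :=
    card_filter_pow_eq (l := 2) (by positivity) two_pos hξ
      (by rwa [show 2 * r * (r + 1) * 2 = (2 * r + 2) * (2 * r) by ring]) hε
  rw [sum_congr rfl fun d _ => hterm d, sum_add_distrib, sum_ite_eq', ← sum_filter, sum_const,
    hhalf]
  simp

theorem card_at_infinity [Fintype F] [DecidableEq F] {ξ : F} {r k : ℕ} (hr : 0 < r)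
    (hcard : Fintype.card F = (2 * r + 1) ^ 2)
    (hξ : ∀ x : F, x ≠ 0 → ∃ m : ℕ, x = ξ ^ m)
    (hp : IsPrimitiveRoot ξ ((2 * r + 2) * (2 * r))) {l : F} (hl0 : l ≠ 0) (hl4 : l ^ 4 ≠ 1)
    (hlq : l ^ (2 * r) = (-1) ^ k) :
    #{p : F × F | Fgam (2 * r + 1) (l + l⁻¹) ![0, 1, p.1, p.2] = 0} =
      (2 * r + 1) ^ 2 * (2 * r + 2) := by
  have hε : ((-1 : F) ^ k) ^ 2 = 1 := by rw [← pow_mul, mul_comm, pow_mul]; simp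
  have hiff : ∀ b c : F, Fgam (2 * r + 1) (l + l⁻¹) ![0, 1, b, c] = 0 ↔
      (b ^ (r + 1) = (-1) ^ r * l ∨ b ^ (r + 1) = (-1) ^ r * l⁻¹) := by
    intro b c
    have hs : ((-1 : F) ^ r) ^ 2 = 1 := by rw [← pow_mul, mul_comm, pow_mul]; simp
    have h1 : Fgam (2 * r + 1) (l + l⁻¹) ![0, 1, b, c] =
        -((b ^ (r + 1) - (-1) ^ r * l) * (b ^ (r + 1) - (-1) ^ r * l⁻¹)) := by
      simp only [Fgam, Matrix.cons_val, show (2 * r + 1 + 1) / 2 = r + 1 by omega]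
      rw [show (0 : F) * c - 1 * b = -1 * b by ring, mul_pow (-1 : F), pow_succ (-1 : F) r]
      have : ((-1 : F) ^ r * l) * ((-1) ^ r * l⁻¹) = 1 := by
        field_simp
        exact hs
      simp only [one_pow, zero_mul, ne_eq, Nat.add_eq_zero_iff, one_ne_zero, and_false,
        not_false_eq_true, zero_pow]
      linear_combination this
    rw [h1, neg_eq_zero, mul_eq_zero, sub_eq_zero, sub_eq_zero]
  have hprim : IsPrimitiveRoot ξ ((r + 1) * (4 * r)) := by
    rwa [show (r + 1) * (4 * r) = (2 * r + 2) * (2 * r) by ring]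
  have hroots : ∀ c : F, c ^ (4 * r) = 1 → #{b : F | b ^ (r + 1) = (-1) ^ r * c} = r + 1 := by
    intro c hc
    refine card_filter_pow_eq (l := 4 * r) (by positivity) (by positivity) hξ hprim ?_
    rw [mul_pow, hc, ← pow_mul, Even.neg_one_pow ⟨r * (2 * r), by ring⟩, one_mul]
  have hl : l ^ (4 * r) = 1 := by
    rw [show 4 * r = 2 * r * 2 by ring, pow_mul, hlq, hε]
  have hdisj : Disjoint (filter (fun b : F => b ^ (r + 1) = (-1) ^ r * l) univ)
      (filter (fun b : F => b ^ (r + 1) = (-1) ^ r * l⁻¹) univ) := by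
    rw [disjoint_filter]
    intro b _ h h'
    have h2 : l = l⁻¹ := mul_left_cancel₀ (pow_ne_zero r (by simp : (-1 : F) ≠ 0)) (h ▸ h')
    have h3 : l ^ 2 = 1 := by
      field_simp at h2
      exact h2
    exact hl4 (by rw [show 4 = 2 * 2 by rfl, pow_mul, h3, one_pow])
  have hprod : filter (fun p : F × F => Fgam (2 * r + 1) (l + l⁻¹) ![0, 1, p.1, p.2] = 0) univ =
      filter (fun b : F => b ^ (r + 1) = (-1) ^ r * l ∨ b ^ (r + 1) = (-1) ^ r * l⁻¹) univ
        ×ˢ univ := by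
    ext ⟨b, c⟩
    simp [hiff]
  rw [hprod, card_product, card_univ, hcard, filter_or, card_union_of_disjoint hdisj,
    hroots l hl, hroots l⁻¹ (by rw [inv_pow, hl, inv_one])]
  ring

end Counting

/-- Lemma 2.6 iii): `|E_k| = q²(q²+1)(q+1)/2 + q² + 1` for `k ∈ {1,…,q−2}`,
    `k ≠ (q−1)/2`. -/
theorem stmt5 {F : Type*} [Field F] [Fintype F] (p n q : ℕ) (hp : p.Prime)
    (hodd : Odd p) (hn : 0 < n) (hq : q = p ^ n) (hF : Fintype.card F = q ^ 2)
    (ξ : F) (hξ : ∀ x : F, x ≠ 0 → ∃ m : ℕ, x = ξ ^ m)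
    (k : ℕ) (hk1 : 1 ≤ k) (hkq : k ≤ q - 2) (hkne : k ≠ (q - 1) / 2) :
    (Cgam q (ξ ^ (k * (q + 1) / 2) + (ξ ^ (k * (q + 1) / 2))⁻¹)).ncard
      = q ^ 2 * (q ^ 2 + 1) * (q + 1) / 2 + q ^ 2 + 1 := by
  classical
  have : Fact p.Prime := ⟨hp⟩
  have hqodd : Odd q := hq ▸ hodd.pow
  have hcard : Fintype.card F = p ^ (n * 2) := by rw [hF, hq, pow_mul]
  have : CharP F p := charP_of_card_eq_prime_pow hcard
  have hadd : ∀ x y : F, (x + y) ^ q = x ^ q + y ^ q := fun x y => by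
    rw [hq, add_pow_char_pow]
  have hneg : (-1 : F) ≠ 1 := by
    have : p ≠ 2 := by
      rintro rfl
      exact absurd hodd (by decide)
    have := Fact.mk (lt_of_le_of_ne hp.two_le this.symm)
    exact CharP.neg_one_ne_one F p
  have hξ0 : ξ ≠ 0 := by
    rintro rfl
    obtain ⟨m, hm⟩ := hξ (-1) (by simp)
    rcases Nat.eq_zero_or_pos m with rfl | h
    · exact hneg (by simpa using hm)
    · rw [zero_pow h.ne'] at hm
      simp at hm
  clear hq
  obtain ⟨r, rfl⟩ := hqodd
  have hr : 0 < r := by omega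
  have hprim := isPrimitiveRoot_of_generates hξ0 hξ
  have hsq : (2 * r + 1) ^ 2 = (2 * r + 2) * (2 * r) + 1 := by ring
  rw [hF, hsq, Nat.add_sub_cancel] at hprim
  have hexp : k * (2 * r + 1 + 1) / 2 = k * (r + 1) := by
    rw [show k * (2 * r + 1 + 1) = k * (r + 1) * 2 by ring]
    simp
  have hhalf : ξ ^ ((r + 1) * (2 * r)) = -1 := by
    refine (sq_eq_one_iff.1 ?_).resolve_left ?_
    · rw [← pow_mul, show (r + 1) * (2 * r) * 2 = (2 * r + 2) * (2 * r) by ring,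
        hprim.pow_eq_one]
    · intro h
      rw [hprim.pow_eq_one_iff_dvd] at h
      have := Nat.le_of_dvd (by positivity) h
      nlinarith
  have hlq : (ξ ^ (k * (r + 1))) ^ (2 * r) = (-1) ^ k := by
    rw [← hhalf, ← pow_mul, ← pow_mul]
    ring
  have hl4 : (ξ ^ (k * (r + 1))) ^ 4 ≠ 1 := by
    rw [← pow_mul, Ne, hprim.pow_eq_one_iff_dvd]
    intro h
    rw [show (2 * r + 2) * (2 * r) = 4 * (r + 1) * r by ring,
      show k * (r + 1) * 4 = 4 * (r + 1) * k by ring] at h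
    obtain ⟨j, rfl⟩ := Nat.dvd_of_mul_dvd_mul_left (by positivity) h
    have h1 : j < 2 := by
      by_contra! hj
      have := Nat.mul_le_mul_left r hj
      omega
    interval_cases j <;> omega
  have hl0 : ξ ^ (k * (r + 1)) ≠ 0 := pow_ne_zero _ hξ0
  rw [hexp, ncard_Cgam_eq _ ⟨r, rfl⟩, card_affine hr hF hadd hξ hprim hl0 hl4 hlq,
    card_at_infinity hr hF hξ hprim hl0 hl4 hlq,
    show (2 * r + 1) ^ 2 * ((2 * r + 1) ^ 2 + 1) * (2 * r + 1 + 1) =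
      (2 * r + 1) ^ 2 * ((2 * r + 1) ^ 2 + 1) * (r + 1) * 2 by ring, Nat.mul_div_cancel _ two_pos]
  ring
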